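/- Let (u,v) be a smooth solution of the Pavlov–Mikhalev system on ℝ³ and let ϑ : ℝ → ℝ be an arbitrary smooth function of t, with derivatives ϑ_t, ϑ_tt. Then the pair (φ^u, φ^v) with φ^u = 0 and φ^v = ((3/2)·u_x² + u_y)·ϑ(t) + (y·u_x + (1/2)·x)·ϑ_t(t) + (1/4)·y²·ϑ_tt(t) satisfies the linearized system, i.e., it is a symmetry generating function (the symmetry φ₁₇[ϑ]). -/

import Mathlib

noncomputable section

/-- Partial derivative with respect to the first coordinate `t`. -/
def Dt (f : ℝ → ℝ → ℝ → ℝ) : ℝ → ℝ → ℝ → ℝ := fun t x y => deriv (fun s => f s x y) t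

/-- Partial derivative with respect to the second coordinate `x`. -/
def Dx (f : ℝ → ℝ → ℝ → ℝ) : ℝ → ℝ → ℝ → ℝ := fun t x y => deriv (fun s => f t s y) x

/-- Partial derivative with respect to the third coordinate `y`. -/
def Dy (f : ℝ → ℝ → ℝ → ℝ) : ℝ → ℝ → ℝ → ℝ := fun t x y => deriv (fun s => f t x s) y

/-- `f` is a smooth function on `ℝ³` (given in curried form, coordinates `(t, x, y)`). -/
def Smooth3 (f : ℝ → ℝ → ℝ → ℝ) : Prop :=
  ContDiff ℝ (⊤ : ℕ∞) (fun p : ℝ × ℝ × ℝ => f p.1 p.2.1 p.2.2)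

/-- The Pavlov–Mikhalev equation `u_yy = u_xt − u_x·u_xy + u_y·u_xx`. -/
def PMu (u : ℝ → ℝ → ℝ → ℝ) : Prop :=
  ∀ t x y : ℝ, Dy (Dy u) t x y =
    Dt (Dx u) t x y - Dx u t x y * Dy (Dx u) t x y + Dy u t x y * Dx (Dx u) t x y

/-- The second equation of the two-component Pavlov–Mikhalev system:
`v_yy = v_xt − u_x·v_xy − 2·v_y·u_xx + 2·v_x·u_xy + u_y·v_xx`. -/
def PMv (u v : ℝ → ℝ → ℝ → ℝ) : Prop :=
  ∀ t x y : ℝ, Dy (Dy v) t x y =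
    Dt (Dx v) t x y - Dx u t x y * Dy (Dx v) t x y
      - 2 * Dy v t x y * Dx (Dx u) t x y + 2 * Dx v t x y * Dy (Dx u) t x y
      + Dy u t x y * Dx (Dx v) t x y

/-- First equation of the linearized system applied to `A = φ^u`:
`φ^u_yy = φ^u_xt + u_xx·φ^u_y + u_y·φ^u_xx − u_x·φ^u_xy − u_xy·φ^u_x`. -/
def LinU (u A : ℝ → ℝ → ℝ → ℝ) : Prop :=
  ∀ t x y : ℝ, Dy (Dy A) t x y =
    Dt (Dx A) t x y + Dx (Dx u) t x y * Dy A t x y + Dy u t x y * Dx (Dx A) t x y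
      - Dx u t x y * Dy (Dx A) t x y - Dy (Dx u) t x y * Dx A t x y

/-- Second equation of the linearized system applied to `(A, B) = (φ^u, φ^v)`. -/
def LinV (u v A B : ℝ → ℝ → ℝ → ℝ) : Prop :=
  ∀ t x y : ℝ, Dy (Dy B) t x y =
    2 * Dx v t x y * Dy (Dx A) t x y - Dy (Dx v) t x y * Dx A t x y
      + Dx (Dx v) t x y * Dy A t x y - 2 * Dy v t x y * Dx (Dx A) t x y
      + Dt (Dx B) t x y + 2 * Dy (Dx u) t x y * Dx B t x y
      - 2 * Dx (Dx u) t x y * Dy B t x y + Dy u t x y * Dx (Dx B) t x y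
      - Dx u t x y * Dy (Dx B) t x y

/-- `(A,B)` is a symmetry generating function of the Pavlov–Mikhalev system over `(u,v)`. -/
def IsSymmetry (u v A B : ℝ → ℝ → ℝ → ℝ) : Prop := LinU u A ∧ LinV u v A B

/-- First equation of the tangent system over a solution `(u,v)`:
`p_yy = u_y·p_xx − u_xy·p_x − u_x·p_xy + u_xx·p_y + p_xt`. -/
def TanP (u p : ℝ → ℝ → ℝ → ℝ) : Prop :=
  ∀ t x y : ℝ, Dy (Dy p) t x y =
    Dy u t x y * Dx (Dx p) t x y - Dy (Dx u) t x y * Dx p t x y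
      - Dx u t x y * Dy (Dx p) t x y + Dx (Dx u) t x y * Dy p t x y + Dt (Dx p) t x y

/-- Second equation of the tangent system over a solution `(u,v)`:
`q_yy = 2·v_x·p_xy + v_xx·p_y − v_xy·p_x − 2·v_y·p_xx + 2·u_xy·q_x + u_y·q_xx
  − u_x·q_xy − 2·u_xx·q_y + q_xt`. -/
def TanQ (u v p q : ℝ → ℝ → ℝ → ℝ) : Prop :=
  ∀ t x y : ℝ, Dy (Dy q) t x y =
    2 * Dx v t x y * Dy (Dx p) t x y + Dx (Dx v) t x y * Dy p t x y
      - Dy (Dx v) t x y * Dx p t x y - 2 * Dy v t x y * Dx (Dx p) t x y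
      + 2 * Dy (Dx u) t x y * Dx q t x y + Dy u t x y * Dx (Dx q) t x y
      - Dx u t x y * Dy (Dx q) t x y - 2 * Dx (Dx u) t x y * Dy q t x y
      + Dt (Dx q) t x y


lemma Dt_eq_of_hasDerivAt {f g : ℝ → ℝ → ℝ → ℝ} (h : f = g) {t x y d : ℝ}
    (hg : HasDerivAt (fun s => g s x y) d t) : Dt f t x y = d :=
  h ▸ hg.deriv

lemma Dx_eq_of_hasDerivAt {f g : ℝ → ℝ → ℝ → ℝ} (h : f = g) {t x y d : ℝ}
    (hg : HasDerivAt (fun s => g t s y) d x) : Dx f t x y = d :=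
  h ▸ hg.deriv

lemma Dy_eq_of_hasDerivAt {f g : ℝ → ℝ → ℝ → ℝ} (h : f = g) {t x y d : ℝ}
    (hg : HasDerivAt (fun s => g t x s) d y) : Dy f t x y = d :=
  h ▸ hg.deriv

namespace Smooth3

variable {f : ℝ → ℝ → ℝ → ℝ}

lemma differentiableAt (hf : Smooth3 f) (p : ℝ × ℝ × ℝ) :
    DifferentiableAt ℝ (fun p : ℝ × ℝ × ℝ => f p.1 p.2.1 p.2.2) p :=
  (ContDiff.differentiable hf (by simp)) p

lemma hasDerivAt_Dt (hf : Smooth3 f) (t x y : ℝ) :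
    HasDerivAt (fun s => f s x y) (Dt f t x y) t := by
  refine DifferentiableAt.hasDerivAt ?_
  exact (hf.differentiableAt (t, x, y)).comp t (f := fun s : ℝ => (s, x, y)) (by fun_prop)

lemma hasDerivAt_Dx (hf : Smooth3 f) (t x y : ℝ) :
    HasDerivAt (fun s => f t s y) (Dx f t x y) x := by
  refine DifferentiableAt.hasDerivAt ?_
  exact (hf.differentiableAt (t, x, y)).comp x (f := fun s : ℝ => (t, s, y)) (by fun_prop)

lemma hasDerivAt_Dy (hf : Smooth3 f) (t x y : ℝ) :
    HasDerivAt (fun s => f t x s) (Dy f t x y) y := by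
  refine DifferentiableAt.hasDerivAt ?_
  exact (hf.differentiableAt (t, x, y)).comp y (f := fun s : ℝ => (t, x, s)) (by fun_prop)

lemma Dt_eq_fderiv (hf : Smooth3 f) (t x y : ℝ) :
    Dt f t x y = fderiv ℝ (fun p : ℝ × ℝ × ℝ => f p.1 p.2.1 p.2.2) (t, x, y) (1, 0, 0) := by
  have hc : HasDerivAt (fun s : ℝ => (s, x, y)) (1, 0, 0) t :=
    (hasDerivAt_id t).prodMk ((hasDerivAt_const t x).prodMk (hasDerivAt_const t y))
  exact ((hf.differentiableAt (t, x, y)).hasFDerivAt.comp_hasDerivAt t hc).deriv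

lemma Dx_eq_fderiv (hf : Smooth3 f) (t x y : ℝ) :
    Dx f t x y = fderiv ℝ (fun p : ℝ × ℝ × ℝ => f p.1 p.2.1 p.2.2) (t, x, y) (0, 1, 0) := by
  have hc : HasDerivAt (fun s : ℝ => (t, s, y)) (0, 1, 0) x :=
    (hasDerivAt_const x t).prodMk ((hasDerivAt_id x).prodMk (hasDerivAt_const x y))
  exact ((hf.differentiableAt (t, x, y)).hasFDerivAt.comp_hasDerivAt x hc).deriv

lemma Dy_eq_fderiv (hf : Smooth3 f) (t x y : ℝ) :
    Dy f t x y = fderiv ℝ (fun p : ℝ × ℝ × ℝ => f p.1 p.2.1 p.2.2) (t, x, y) (0, 0, 1) := by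
  have hc : HasDerivAt (fun s : ℝ => (t, x, s)) (0, 0, 1) y :=
    (hasDerivAt_const y t).prodMk ((hasDerivAt_const y x).prodMk (hasDerivAt_id y))
  exact ((hf.differentiableAt (t, x, y)).hasFDerivAt.comp_hasDerivAt y hc).deriv

lemma contDiff_fderiv (hf : Smooth3 f) :
    ContDiff ℝ (⊤ : ℕ∞) (fderiv ℝ (fun p : ℝ × ℝ × ℝ => f p.1 p.2.1 p.2.2)) :=
  ContDiff.fderiv_right hf (by simp)

lemma Dt (hf : Smooth3 f) : Smooth3 (Dt f) := by
  simp only [Smooth3, hf.Dt_eq_fderiv]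
  exact hf.contDiff_fderiv.clm_apply contDiff_const

lemma Dx (hf : Smooth3 f) : Smooth3 (Dx f) := by
  simp only [Smooth3, hf.Dx_eq_fderiv]
  exact hf.contDiff_fderiv.clm_apply contDiff_const

lemma Dy (hf : Smooth3 f) : Smooth3 (Dy f) := by
  simp only [Smooth3, hf.Dy_eq_fderiv]
  exact hf.contDiff_fderiv.clm_apply contDiff_const

lemma fderiv_fderiv_apply_comm (hf : Smooth3 f) (p a b : ℝ × ℝ × ℝ) :
    fderiv ℝ (fun q => fderiv ℝ (fun p : ℝ × ℝ × ℝ => f p.1 p.2.1 p.2.2) q a) p b =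
      fderiv ℝ (fun q => fderiv ℝ (fun p : ℝ × ℝ × ℝ => f p.1 p.2.1 p.2.2) q b) p a := by
  have hd := (hf.contDiff_fderiv.differentiable (by simp)) p
  rw [fderiv_clm_apply hd (by fun_prop), fderiv_clm_apply hd (by fun_prop)]
  simpa using (ContDiff.contDiffAt hf).isSymmSndFDerivAt
    (by rw [minSmoothness_of_isRCLikeNormedField]; exact WithTop.coe_le_coe.2 le_top) b a

lemma Dx_Dy_comm (hf : Smooth3 f) : _root_.Dx (_root_.Dy f) = _root_.Dy (_root_.Dx f) := by
  funext t x y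
  rw [hf.Dy.Dx_eq_fderiv, hf.Dx.Dy_eq_fderiv]
  simp only [hf.Dx_eq_fderiv, hf.Dy_eq_fderiv]
  exact hf.fderiv_fderiv_apply_comm _ _ _

lemma Dx_Dt_comm (hf : Smooth3 f) : _root_.Dx (_root_.Dt f) = _root_.Dt (_root_.Dx f) := by
  funext t x y
  rw [hf.Dt.Dx_eq_fderiv, hf.Dx.Dt_eq_fderiv]
  simp only [hf.Dx_eq_fderiv, hf.Dt_eq_fderiv]
  exact hf.fderiv_fderiv_apply_comm _ _ _

lemma Dy_Dt_comm (hf : Smooth3 f) : _root_.Dy (_root_.Dt f) = _root_.Dt (_root_.Dy f) := by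
  funext t x y
  rw [hf.Dt.Dy_eq_fderiv, hf.Dy.Dt_eq_fderiv]
  simp only [hf.Dy_eq_fderiv, hf.Dt_eq_fderiv]
  exact hf.fderiv_fderiv_apply_comm _ _ _

end Smooth3

lemma PMu.Dx_eq {u : ℝ → ℝ → ℝ → ℝ} (hu : Smooth3 u) (h : PMu u) (t x y : ℝ) :
    Dy (Dy (Dx u)) t x y = Dt (Dx (Dx u)) t x y - Dx u t x y * Dy (Dx (Dx u)) t x y
      + Dy u t x y * Dx (Dx (Dx u)) t x y := by
  have e : Dy (Dy u) = fun t x y => Dt (Dx u) t x y - Dx u t x y * Dy (Dx u) t x y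
      + Dy u t x y * Dx (Dx u) t x y := by
    funext t x y
    exact h t x y
  have hr := Dx_eq_of_hasDerivAt e (t := t) (x := x) (y := y) <|
    (((hu.Dx.Dt.hasDerivAt_Dx t x y).sub
      ((hu.Dx.hasDerivAt_Dx t x y).mul (hu.Dx.Dy.hasDerivAt_Dx t x y))).add
      ((hu.Dy.hasDerivAt_Dx t x y).mul (hu.Dx.Dx.hasDerivAt_Dx t x y)))
  rw [hu.Dy.Dx_Dy_comm, hu.Dx_Dy_comm, hu.Dx.Dx_Dt_comm, hu.Dx.Dx_Dy_comm] at hr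
  linear_combination hr

lemma PMu.Dy_eq {u : ℝ → ℝ → ℝ → ℝ} (hu : Smooth3 u) (h : PMu u) (t x y : ℝ) :
    Dy (Dy (Dy u)) t x y = Dt (Dy (Dx u)) t x y - Dy (Dx u) t x y ^ 2
      - Dx u t x y * Dy (Dy (Dx u)) t x y + Dy (Dy u) t x y * Dx (Dx u) t x y
      + Dy u t x y * Dy (Dx (Dx u)) t x y := by
  have e : Dy (Dy u) = fun t x y => Dt (Dx u) t x y - Dx u t x y * Dy (Dx u) t x y
      + Dy u t x y * Dx (Dx u) t x y := by
    funext t x y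
    exact h t x y
  have hr := Dy_eq_of_hasDerivAt e (t := t) (x := x) (y := y) <|
    (((hu.Dx.Dt.hasDerivAt_Dy t x y).sub
      ((hu.Dx.hasDerivAt_Dy t x y).mul (hu.Dx.Dy.hasDerivAt_Dy t x y))).add
      ((hu.Dy.hasDerivAt_Dy t x y).mul (hu.Dx.Dx.hasDerivAt_Dy t x y)))
  rw [hu.Dx.Dy_Dt_comm] at hr
  linear_combination hr

theorem phi17_is_symmetry (u v : ℝ → ℝ → ℝ → ℝ) (hu : Smooth3 u) (hv : Smooth3 v)
    (hPMu : PMu u) (hPMv : PMv u v)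
    (ϑ : ℝ → ℝ) (hϑ : ContDiff ℝ (⊤ : ℕ∞) ϑ) :
    IsSymmetry u v
      (fun _t _x _y => (0 : ℝ))
      (fun t x y => ((3/2) * (Dx u t x y)^2 + Dy u t x y) * ϑ t
        + (y * Dx u t x y + (1/2) * x) * deriv ϑ t + (1/4) * y^2 * deriv (deriv ϑ) t) := by
  have hϑ' : ContDiff ℝ (⊤ : ℕ∞) (deriv ϑ) := (contDiff_infty_iff_deriv.mp hϑ).2
  have dϑ (t : ℝ) : HasDerivAt ϑ (deriv ϑ t) t := (hϑ.differentiable (by simp) t).hasDerivAt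
  have dϑ' (t : ℝ) : HasDerivAt (deriv ϑ) (deriv (deriv ϑ) t) t :=
    (hϑ'.differentiable (by simp) t).hasDerivAt
  have hp := hu.Dx
  have hq := hu.Dy
  have hpx := hp.Dx
  have hpy := hp.Dy
  have hqy := hq.Dy
  have hqx : Dx (Dy u) = Dy (Dx u) := hu.Dx_Dy_comm
  refine ⟨fun t x y => by simp [Dx, Dy, Dt], fun t x y => ?_⟩
  have hA : Dx (fun _ _ _ => (0 : ℝ)) = fun _ _ _ => 0 := by funext t x y; simp [Dx]
  have hA' : Dy (fun _ _ _ => (0 : ℝ)) = fun _ _ _ => 0 := by funext t x y; simp [Dy]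
  set B : ℝ → ℝ → ℝ → ℝ := fun t x y => ((3/2) * (Dx u t x y)^2 + Dy u t x y) * ϑ t
    + (y * Dx u t x y + (1/2) * x) * deriv ϑ t + (1/4) * y^2 * deriv (deriv ϑ) t
  have hBx : Dx B = fun t x y =>
      (3 * (Dx u t x y * Dx (Dx u) t x y) + Dy (Dx u) t x y) * ϑ t
        + (y * Dx (Dx u) t x y + 1 / 2) * deriv ϑ t := by
    funext t x y
    have hd := ((((((hp.hasDerivAt_Dx t x y).pow 2).const_mul (3 / 2)).add
      (hq.hasDerivAt_Dx t x y)).mul_const (ϑ t)).add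
      ((((hp.hasDerivAt_Dx t x y).const_mul y).add
        ((hasDerivAt_id x).const_mul (1 / 2))).mul_const (deriv ϑ t))).add_const
      ((1/4) * y^2 * deriv (deriv ϑ) t)
    refine hd.deriv.trans ?_
    rw [hqx]
    norm_num only [id]
    ring
  have hBy : Dy B = fun t x y =>
      (3 * (Dx u t x y * Dy (Dx u) t x y) + Dy (Dy u) t x y) * ϑ t
        + (Dx u t x y + y * Dy (Dx u) t x y) * deriv ϑ t
        + y * (1 / 2 * deriv (deriv ϑ) t) := by
    funext t x y
    have hd := ((((((hp.hasDerivAt_Dy t x y).pow 2).const_mul (3 / 2)).add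
      (hq.hasDerivAt_Dy t x y)).mul_const (ϑ t)).add
      ((((hasDerivAt_id y).mul (hp.hasDerivAt_Dy t x y)).add_const
        ((1 / 2) * x)).mul_const (deriv ϑ t))).add
      ((((hasDerivAt_id y).pow 2).const_mul (1 / 4)).mul_const (deriv (deriv ϑ) t))
    refine hd.deriv.trans ?_
    norm_num only [id]
    ring
  have hBxx := Dx_eq_of_hasDerivAt hBx (t := t) (x := x) (y := y) <|
    ((((((hp.hasDerivAt_Dx t x y).mul (hpx.hasDerivAt_Dx t x y)).const_mul 3).add
      (hpy.hasDerivAt_Dx t x y)).mul_const (ϑ t)).add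
      ((((hpx.hasDerivAt_Dx t x y).const_mul y).add_const (1 / 2)).mul_const (deriv ϑ t)))
  have hBxy := Dy_eq_of_hasDerivAt hBx (t := t) (x := x) (y := y) <|
    ((((((hp.hasDerivAt_Dy t x y).mul (hpx.hasDerivAt_Dy t x y)).const_mul 3).add
      (hpy.hasDerivAt_Dy t x y)).mul_const (ϑ t)).add
      ((((hasDerivAt_id y).mul (hpx.hasDerivAt_Dy t x y)).add_const
        (1 / 2)).mul_const (deriv ϑ t)))
  have hBxt := Dt_eq_of_hasDerivAt hBx (t := t) (x := x) (y := y) <|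
    ((((((hp.hasDerivAt_Dt t x y).mul (hpx.hasDerivAt_Dt t x y)).const_mul 3).add
      (hpy.hasDerivAt_Dt t x y)).mul (dϑ t)).add
      ((((hpx.hasDerivAt_Dt t x y).const_mul y).add_const (1 / 2)).mul (dϑ' t)))
  have hByy := Dy_eq_of_hasDerivAt hBy (t := t) (x := x) (y := y) <|
    ((((((hp.hasDerivAt_Dy t x y).mul (hpy.hasDerivAt_Dy t x y)).const_mul 3).add
      (hqy.hasDerivAt_Dy t x y)).mul_const (ϑ t)).add
      (((hp.hasDerivAt_Dy t x y).add
        ((hasDerivAt_id y).mul (hpy.hasDerivAt_Dy t x y))).mul_const (deriv ϑ t))).add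
      ((hasDerivAt_id y).mul_const (1 / 2 * deriv (deriv ϑ) t))
  rw [hp.Dx_Dy_comm] at hBxx
  rw [hBxx, hBxy, hBxt, hByy, hBx, hBy, hA, hA']
  simp only [hA, id, Pi.mul_apply, Pi.add_apply]
  linear_combination (3 * Dx u t x y * ϑ t + y * deriv ϑ t) * hPMu.Dx_eq hu t x y
    + ϑ t * hPMu.Dy_eq hu t x y + 3 * Dx (Dx u) t x y * ϑ t * hPMu t x y
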